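/- arXiv:math/0701109 — 3 statements merged into one kernel-verified Lean document; each statement's English description precedes it below -/
import Mathlib

section
/- The two ℂ-derivations δ' = y1 ∂/∂y3 + y2 ∂/∂y4 + (1+y1) ∂/∂z2 + z2 ∂/∂z1 and δ = y2 ∂/∂y3 + ∂/∂z1 of the polynomial ring ℂ[y1, y2, y3, y4, z1, z2] commute: δ ∘ δ' = δ' ∘ δ, i.e., their commutator ⁅δ, δ'⁆ is the zero derivation. -/
open MvPolynomial

/-- The derivation `δ' = y1 ∂/∂y3 + y2 ∂/∂y4 + (1+y1) ∂/∂z2 + z2 ∂/∂z1` of the polynomial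
ring `ℂ[y1, y2, y3, y4, z1, z2]` (the variables `y1, y2, y3, y4, z1, z2` are indexed by
`0, 1, 2, 3, 4, 5`): it sends `y1 ↦ 0`, `y2 ↦ 0`, `y3 ↦ y1`, `y4 ↦ y2`, `z1 ↦ z2`,
`z2 ↦ 1 + y1`. -/
noncomputable def deltaW' :
    Derivation ℂ (MvPolynomial (Fin 6) ℂ) (MvPolynomial (Fin 6) ℂ) :=
  mkDerivation ℂ ![0, 0, X 0, X 1, X 5, 1 + X 0]

/-- The derivation `δ = y2 ∂/∂y3 + ∂/∂z1` of `ℂ[y1, y2, y3, y4, z1, z2]`: it sends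
`y3 ↦ y2`, `z1 ↦ 1` and all other variables to `0`. -/
noncomputable def deltaW :
    Derivation ℂ (MvPolynomial (Fin 6) ℂ) (MvPolynomial (Fin 6) ℂ) :=
  mkDerivation ℂ ![0, 0, X 1, 0, 1, 0]

/-- The commutator of `δ` and `δ'` vanishes, as it vanishes on every variable. -/
theorem lie_deltaW_deltaW' : ⁅deltaW, deltaW'⁆ = 0 := by
  refine MvPolynomial.derivation_ext fun i => ?_
  fin_cases i <;> simp [Derivation.commutator_apply, deltaW, deltaW', mkDerivation_X]

/-- The derivations `δ` and `δ'` commute: `δ ∘ δ' = δ' ∘ δ`, i.e. their commutator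
`⁅δ, δ'⁆` is the zero derivation. -/
theorem deltaW_comm :
    (∀ p : MvPolynomial (Fin 6) ℂ, deltaW (deltaW' p) = deltaW' (deltaW p)) ∧
    deltaW.toLinearMap ∘ₗ deltaW'.toLinearMap = deltaW'.toLinearMap ∘ₗ deltaW.toLinearMap := by
  have h (p : MvPolynomial (Fin 6) ℂ) : deltaW (deltaW' p) = deltaW' (deltaW p) := by
    rw [← sub_eq_zero, ← Derivation.commutator_apply, lie_deltaW_deltaW', Derivation.zero_apply]
  exact ⟨h, LinearMap.ext h⟩
end

section
/- The two ℂ-derivations δ1 = ∂/∂z1 + y1 ∂/∂z2 and δ2 = y1 ∂/∂y2 + y2 ∂/∂y3 + y3 ∂/∂z1 + ∂/∂z2 of the polynomial ring ℂ[y1, y2, y3, z1, z2] commute (δ1 ∘ δ2 = δ2 ∘ δ1), and both are locally nilpotent: for every polynomial p there exist n, m ∈ ℕ with δ1^n(p) = 0 and δ2^m(p) = 0. -/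
open MvPolynomial

/-- The derivation `δ1 = ∂/∂z1 + y1 ∂/∂z2` of the polynomial ring `ℂ[y1, y2, y3, z1, z2]`
(variables `y1, y2, y3, z1, z2` indexed by `0, 1, 2, 3, 4`): it sends `y1, y2, y3 ↦ 0`,
`z1 ↦ 1`, `z2 ↦ y1`. -/
noncomputable def delta1 :
    Derivation ℂ (MvPolynomial (Fin 5) ℂ) (MvPolynomial (Fin 5) ℂ) :=
  mkDerivation ℂ ![0, 0, 0, 1, X 0]

/-- The derivation `δ2 = y1 ∂/∂y2 + y2 ∂/∂y3 + y3 ∂/∂z1 + ∂/∂z2` of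
`ℂ[y1, y2, y3, z1, z2]`: it sends `y1 ↦ 0`, `y2 ↦ y1`, `y3 ↦ y2`, `z1 ↦ y3`, `z2 ↦ 1`. -/
noncomputable def delta2 :
    Derivation ℂ (MvPolynomial (Fin 5) ℂ) (MvPolynomial (Fin 5) ℂ) :=
  mkDerivation ℂ ![0, X 0, X 1, X 2, 1]

/-- If `Dⁿ a = 0` and `Dᵐ b = 0` for a derivation `D`, then `Dⁿ⁺ᵐ (a * b) = 0`. -/
theorem Derivation.pow_add_apply_mul_eq_zero {R A : Type*} [CommRing R] [CommRing A] [Algebra R A]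
    (D : Derivation R A A) {n m : ℕ} {a b : A} (ha : (D.toLinearMap ^ n) a = 0)
    (hb : (D.toLinearMap ^ m) b = 0) : (D.toLinearMap ^ (n + m)) (a * b) = 0 := by
  induction h : n + m generalizing n m a b with
  | zero =>
    obtain rfl : n = 0 := by omega
    have : a = 0 := by simpa using ha
    simp [this]
  | succ s ih =>
    rcases n with _ | n
    · have : a = 0 := by simpa using ha
      simp [this]
    rcases m with _ | m
    · have : b = 0 := by simpa using hb
      simp [this]
    have hD : D.toLinearMap (a * b) = a * D.toLinearMap b + D.toLinearMap a * b := by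
      simp [mul_comm]
    rw [pow_succ, Module.End.mul_apply, hD, map_add]
    rw [ih ha (b := D.toLinearMap b) (m := m) (by rwa [pow_succ] at hb) (by omega),
      ih (a := D.toLinearMap a) (n := n) (by rwa [pow_succ] at ha) hb (by omega), add_zero]

/-- A derivation of a polynomial ring is locally nilpotent if it is nilpotent on every variable. -/
theorem MvPolynomial.exists_derivation_pow_apply_eq_zero {σ R : Type*} [CommRing R]
    (D : Derivation R (MvPolynomial σ R) (MvPolynomial σ R))
    (hX : ∀ i, ∃ n : ℕ, (D.toLinearMap ^ n) (X i) = 0) (p : MvPolynomial σ R) :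
    ∃ n : ℕ, (D.toLinearMap ^ n) p = 0 := by
  induction p using MvPolynomial.induction_on with
  | C r => exact ⟨1, by simp⟩
  | add p q hp hq =>
    obtain ⟨n, hn⟩ := hp
    obtain ⟨m, hm⟩ := hq
    refine ⟨n + m, ?_⟩
    rw [map_add, Module.End.pow_map_zero_of_le (Nat.le_add_right n m) hn,
      Module.End.pow_map_zero_of_le (Nat.le_add_left m n) hm, add_zero]
  | mul_X p i hp =>
    obtain ⟨n, hn⟩ := hp
    obtain ⟨m, hm⟩ := hX i
    exact ⟨n + m, D.pow_add_apply_mul_eq_zero hn hm⟩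

/-- The derivations `δ1` and `δ2` commute (`δ1 ∘ δ2 = δ2 ∘ δ1`) and both are locally
nilpotent: for every polynomial `p` there are `n, m ∈ ℕ` with `δ1ⁿ(p) = 0` and
`δ2ᵐ(p) = 0`. -/
theorem delta1_delta2_comm_locally_nilpotent :
    (∀ p : MvPolynomial (Fin 5) ℂ, delta1 (delta2 p) = delta2 (delta1 p)) ∧
    (∀ p : MvPolynomial (Fin 5) ℂ,
      (∃ n : ℕ, (delta1.toLinearMap ^ n) p = 0) ∧
      (∃ m : ℕ, (delta2.toLinearMap ^ m) p = 0)) := by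
  have hcomm : ⁅delta1, delta2⁆ = 0 := by
    refine derivation_ext fun i => ?_
    fin_cases i <;> simp [Derivation.commutator_apply, delta1, delta2, mkDerivation_X]
  refine ⟨fun p => ?_, fun p => ⟨exists_derivation_pow_apply_eq_zero _ (fun i => ⟨3, ?_⟩) p,
    exists_derivation_pow_apply_eq_zero _ (fun i => ⟨4, ?_⟩) p⟩⟩
  · rw [← sub_eq_zero, ← Derivation.commutator_apply, hcomm, Derivation.zero_apply]
  · fin_cases i <;> simp [pow_succ, delta1, mkDerivation_X]
  · fin_cases i <;> simp [pow_succ, delta2, mkDerivation_X]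
end

section
/- Let V be a finite-dimensional complex vector space, f : V → V a nilpotent linear endomorphism, Z ∈ V a nonzero vector with Z ∉ range(f), and W ⊆ V a linear subspace with range(f) ⊆ W and V = W ⊕ ℂ·Z. Then the map Φ : ℂ × W → V defined by Φ(t, w) = exp(t·f)(w) + t·Z is a bijection; i.e., W is a global slice of the free affine ℂ-action t·Y = exp(t·f)(Y) + t·Z on V. -/
/-- The exponential of a (nilpotent) endomorphism of a finite-dimensional complex vector
space: `exp f = ∑ₙ fⁿ/n!`.  For a nilpotent endomorphism the nilpotency index is at most
`finrank ℂ V`, so the truncated sum below equals the full exponential series. -/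
noncomputable def expEnd {V : Type*} [AddCommGroup V] [Module ℂ V]
    (f : Module.End ℂ V) : Module.End ℂ V :=
  ∑ n ∈ Finset.range (Module.finrank ℂ V + 1), ((n.factorial : ℂ)⁻¹) • f ^ n

theorem exists_expEnd_eq_one_add_mul {V : Type*} [AddCommGroup V] [Module ℂ V]
    (g : Module.End ℂ V) : ∃ q : Module.End ℂ V, Commute g q ∧ expEnd g = 1 + g * q := by
  refine ⟨∑ n ∈ Finset.range (Module.finrank ℂ V), (((n + 1).factorial : ℂ)⁻¹) • g ^ n, ?_, ?_⟩
  · exact Commute.sum_right _ _ _ fun n _ => ((Commute.refl g).pow_right n).smul_right _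
  · simp [expEnd, Finset.sum_range_succ', Finset.mul_sum, pow_succ', add_comm]

theorem isUnit_expEnd {V : Type*} [AddCommGroup V] [Module ℂ V]
    {g : Module.End ℂ V} (hg : IsNilpotent g) : IsUnit (expEnd g) := by
  obtain ⟨q, hq, h⟩ := exists_expEnd_eq_one_add_mul g
  rw [h]
  exact (hq.isNilpotent_mul_right hg).isUnit_one_add

theorem expEnd_apply_sub_mem_range {V : Type*} [AddCommGroup V] [Module ℂ V]
    (g : Module.End ℂ V) (v : V) : expEnd g v - v ∈ LinearMap.range g := by
  obtain ⟨q, -, h⟩ := exists_expEnd_eq_one_add_mul g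
  exact ⟨q v, by simp [h]⟩

theorem expEnd_smul_apply_mem_iff {V : Type*} [AddCommGroup V] [Module ℂ V]
    {f : Module.End ℂ V} {W : Submodule ℂ V} (hrange : LinearMap.range f ≤ W) (t : ℂ) (v : V) :
    expEnd (t • f) v ∈ W ↔ v ∈ W := by
  have h : expEnd (t • f) v - v ∈ W := by
    obtain ⟨x, hx⟩ := expEnd_apply_sub_mem_range (t • f) v
    rw [← hx]
    exact W.smul_mem t (hrange ⟨x, rfl⟩)
  exact ⟨fun hv => by simpa using W.sub_mem hv h, fun hv => by simpa using W.add_mem h hv⟩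

/-- Let `V` be a finite-dimensional complex vector space, `f : V → V` a nilpotent linear
endomorphism, `Z ∈ V` a nonzero vector with `Z ∉ range f`, and `W ⊆ V` a linear subspace
with `range f ⊆ W` and `V = W ⊕ ℂ·Z`.  Then `Φ : ℂ × W → V`,
`Φ(t, w) = exp(t·f)(w) + t·Z`, is a bijection; i.e. `W` is a global slice of the free
affine `ℂ`-action `t·Y = exp(t·f)(Y) + t·Z` on `V`. -/
theorem slice_of_affine_C_action_bijective
    (V : Type*) [AddCommGroup V] [Module ℂ V] [FiniteDimensional ℂ V]
    (f : Module.End ℂ V) (hf : IsNilpotent f) (Z : V) (hZ : Z ≠ 0)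
    (hZf : Z ∉ LinearMap.range f) (W : Submodule ℂ V)
    (hrange : LinearMap.range f ≤ W) (hcompl : IsCompl W (Submodule.span ℂ {Z})) :
    Function.Bijective (fun p : ℂ × W => expEnd (p.1 • f) (p.2 : V) + p.1 • Z) := by
  have hbij (t : ℂ) : Function.Bijective (expEnd (t • f)) :=
    (Module.End.isUnit_iff _).1 (isUnit_expEnd (hf.smul t))
  have hZW : Z ∉ W := fun h =>
    hZ (Submodule.disjoint_def.1 hcompl.disjoint Z h (Submodule.mem_span_singleton_self Z))
  constructor
  · rintro ⟨t, w⟩ ⟨s, w'⟩ h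
    dsimp only at h
    obtain rfl : t = s := by
      by_contra hts
      have hmem : (t - s) • Z ∈ W := by
        have : (t - s) • Z = expEnd (s • f) (w' : V) - expEnd (t • f) (w : V) := by
          rw [sub_smul, sub_eq_sub_iff_add_eq_add, add_comm, h]
        rw [this]
        exact W.sub_mem ((expEnd_smul_apply_mem_iff hrange s _).2 w'.2)
          ((expEnd_smul_apply_mem_iff hrange t _).2 w.2)
      exact hZW ((W.smul_mem_iff (sub_ne_zero.2 hts)).1 hmem)
    rw [Subtype.ext ((hbij t).1 (add_right_cancel h))]
  · intro v
    have hv : v ∈ W ⊔ Submodule.span ℂ {Z} := hcompl.sup_eq_top ▸ Submodule.mem_top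
    obtain ⟨w, hw, z, hz, rfl⟩ := Submodule.mem_sup.1 hv
    obtain ⟨t, rfl⟩ := Submodule.mem_span_singleton.1 hz
    obtain ⟨y, rfl⟩ := (hbij t).2 w
    exact ⟨(t, ⟨y, (expEnd_smul_apply_mem_iff hrange t y).1 hw⟩), rfl⟩
end
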